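/- Let X be a reduced plane quartic all of whose singular points are double points (points of multiplicity 2). Then X has only finitely many theta-lines. -/

import Mathlib

open MvPolynomial

noncomputable section

abbrev P2 : Type := Projectivization ℂ (Fin 3 → ℂ)

/-- The zero locus in `ℙ²` of a polynomial `F`: the points all of whose
representative vectors are zeros of `F`. -/
def curve (F : MvPolynomial (Fin 3) ℂ) : Set P2 :=
  {p | ∀ (w : Fin 3 → ℂ) (hw : w ≠ 0), Projectivization.mk ℂ w hw = p → eval w F = 0}

/-- The projective line spanned by two vectors. -/
def lineThrough (u v : Fin 3 → ℂ) : Set P2 :=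
  {p | ∃ s t : ℂ, ∃ h : s • u + t • v ≠ 0, p = Projectivization.mk ℂ (s • u + t • v) h}

/-- A subset of `ℙ²` is a line if it is the projective span of two
linearly independent vectors. -/
def IsLine (S : Set P2) : Prop :=
  ∃ u v : Fin 3 → ℂ, LinearIndependent ℂ ![u, v] ∧ S = lineThrough u v

/-- The restriction of `F` to the affine parametrization `t ↦ a + t • b` of the line
through `[a]` and `[b]`, as a polynomial in `t`. -/
def lineRest (F : MvPolynomial (Fin 3) ℂ) (a b : Fin 3 → ℂ) : Polynomial ℂ :=
  eval₂ Polynomial.C (fun i => Polynomial.C (a i) + Polynomial.X * Polynomial.C (b i)) F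

/-- The local intersection multiplicity, at the point `[a]`, of the curve `F = 0` with the
line through `[a]` and `[b]` (parametrized by `t ↦ a + t • b`, the point `[a]`
corresponding to `t = 0`). -/
def multAt (F : MvPolynomial (Fin 3) ℂ) (a b : Fin 3 → ℂ) : ℕ :=
  Polynomial.rootMultiplicity 0 (lineRest F a b)

/-- The scheme `X ∩ L` (for `X = {F = 0}`, `L` a line) is everywhere nonreduced: at each
point of `X ∩ L` the local intersection multiplicity is at least `2`.  (Stated over all
parametrizations of `L`; the base point `a` of a parametrization is a point of `L`, and
every point of `L` occurs as such a base point.) -/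
def EverywhereTangent (F : MvPolynomial (Fin 3) ℂ) (S : Set P2) : Prop :=
  ∀ a b : Fin 3 → ℂ, LinearIndependent ℂ ![a, b] → S = lineThrough a b →
    ∀ ha : a ≠ 0, Projectivization.mk ℂ a ha ∈ curve F → 2 ≤ multAt F a b

/-- A theta-line of the quartic `F`: either contained in the curve, or intersecting it
everywhere nonreducedly. -/
def ThetaLine (F : MvPolynomial (Fin 3) ℂ) (S : Set P2) : Prop :=
  IsLine S ∧ (S ⊆ curve F ∨ EverywhereTangent F S)

/-- A bitangent line of (a smooth curve) `F = 0`: a line, not contained in the curve,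
whose scheme-theoretic intersection with the curve is everywhere nonreduced. -/
def Bitangent (F : MvPolynomial (Fin 3) ℂ) (S : Set P2) : Prop :=
  IsLine S ∧ ¬ S ⊆ curve F ∧ EverywhereTangent F S

/-- The line `S` is tangent to the curve `F = 0` at the point `q`: the local intersection
multiplicity there is at least `2`. -/
def TangentAt (F : MvPolynomial (Fin 3) ℂ) (S : Set P2) (q : P2) : Prop :=
  IsLine S ∧ q ∈ S ∧ q ∈ curve F ∧
    ∀ a b : Fin 3 → ℂ, LinearIndependent ℂ ![a, b] → S = lineThrough a b →
      ∀ ha : a ≠ 0, Projectivization.mk ℂ a ha = q → 2 ≤ multAt F a b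

/-- The curve `F = 0` is smooth: `F` and its partial derivatives have no common
projective zero. -/
def SmoothCurve (F : MvPolynomial (Fin 3) ℂ) : Prop :=
  ∀ w : Fin 3 → ℂ, w ≠ 0 → ¬ (eval w F = 0 ∧ ∀ i : Fin 3, eval w (pderiv i F) = 0)

/-- Iterated partial derivative along a list of coordinate directions. -/
def pderivList (l : List (Fin 3)) (F : MvPolynomial (Fin 3) ℂ) : MvPolynomial (Fin 3) ℂ :=
  l.foldr (fun i G => pderiv i G) F

/-- `F` vanishes to order at least `m` at the point `p` (all partial derivatives of
order `< m` vanish at `p`); i.e. `p` is a point of multiplicity at least `m` of `F = 0`. -/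
def VanishesToOrder (F : MvPolynomial (Fin 3) ℂ) (p : P2) (m : ℕ) : Prop :=
  ∀ l : List (Fin 3), l.length < m →
    ∀ (w : Fin 3 → ℂ) (hw : w ≠ 0), Projectivization.mk ℂ w hw = p →
      eval w (pderivList l F) = 0

/-- `p` is a singular point of the curve `F = 0`. -/
def IsSingularAt (F : MvPolynomial (Fin 3) ℂ) (p : P2) : Prop :=
  VanishesToOrder F p 2

/-- `p` is a double point: a point of multiplicity exactly `2`. -/
def IsDoublePoint (F : MvPolynomial (Fin 3) ℂ) (p : P2) : Prop :=
  VanishesToOrder F p 2 ∧ ¬ VanishesToOrder F p 3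

/-- The quadratic form (in the direction `b`) cutting out the tangent cone of `F = 0`
at the double point `[a]`: the degree-`2` Taylor coefficient of `t ↦ F (a + t • b)`. -/
def coneCoeff (F : MvPolynomial (Fin 3) ℂ) (a b : Fin 3 → ℂ) : ℂ :=
  (lineRest F a b).coeff 2

/-- `p` is an ordinary node: a double point whose tangent cone consists of two distinct
lines, i.e. the tangent-cone quadratic has two null directions independent modulo `a`. -/
def OrdinaryNode (F : MvPolynomial (Fin 3) ℂ) (p : P2) : Prop :=
  IsDoublePoint F p ∧
    ∀ (a : Fin 3 → ℂ) (ha : a ≠ 0), Projectivization.mk ℂ a ha = p →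
      ∃ b₁ b₂ : Fin 3 → ℂ, LinearIndependent ℂ ![a, b₁, b₂] ∧
        coneCoeff F a b₁ = 0 ∧ coneCoeff F a b₂ = 0

/-- At the double point `[a]`, the tangent cone is the double line through `[a]` and
`[b₀]`: `b₀` is a null direction of the tangent-cone quadratic, and every null
direction lies on the line spanned by `a` and `b₀`. -/
def DoubleLineCone (F : MvPolynomial (Fin 3) ℂ) (a b₀ : Fin 3 → ℂ) : Prop :=
  LinearIndependent ℂ ![a, b₀] ∧ coneCoeff F a b₀ = 0 ∧
    ∀ b : Fin 3 → ℂ, coneCoeff F a b = 0 → b ∈ Submodule.span ℂ ({a, b₀} : Set (Fin 3 → ℂ))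

/-- `p` is an ordinary cusp: a double point whose tangent cone is a double line `L₀`
with local intersection multiplicity `i(L₀ · X) = 3` at `p`. -/
def OrdinaryCusp (F : MvPolynomial (Fin 3) ℂ) (p : P2) : Prop :=
  IsDoublePoint F p ∧
    ∀ (a : Fin 3 → ℂ) (ha : a ≠ 0), Projectivization.mk ℂ a ha = p →
      ∃ b₀ : Fin 3 → ℂ, DoubleLineCone F a b₀ ∧ multAt F a b₀ = 3

/-- `p` is an ordinary tacnode: a double point whose tangent cone is a double line `L₀`
with local intersection multiplicity `i(L₀ · X) = 4` at `p`. -/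
def OrdinaryTacnode (F : MvPolynomial (Fin 3) ℂ) (p : P2) : Prop :=
  IsDoublePoint F p ∧
    ∀ (a : Fin 3 → ℂ) (ha : a ≠ 0), Projectivization.mk ℂ a ha = p →
      ∃ b₀ : Fin 3 → ℂ, DoubleLineCone F a b₀ ∧ multAt F a b₀ = 4

/-- A theta-line of type `i`: a theta-line, not a component of the curve, containing
exactly `i` singular points of the curve. -/
def ThetaLineOfType (F : MvPolynomial (Fin 3) ℂ) (i : ℕ) (S : Set P2) : Prop :=
  ThetaLine F S ∧ ¬ S ⊆ curve F ∧ {p | p ∈ S ∧ IsSingularAt F p}.ncard = i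

/-- Three points of `ℙ²` are collinear. -/
def Collin (p q r : P2) : Prop :=
  ∃ S : Set P2, IsLine S ∧ p ∈ S ∧ q ∈ S ∧ r ∈ S


/-- An ordinary bitangent: a bitangent meeting the curve at exactly two distinct points,
each with local intersection multiplicity exactly `2`. -/
def OrdinaryBitangent (F : MvPolynomial (Fin 3) ℂ) (S : Set P2) : Prop :=
  Bitangent F S ∧ (S ∩ curve F).ncard = 2 ∧
    ∀ a b : Fin 3 → ℂ, LinearIndependent ℂ ![a, b] → S = lineThrough a b →
      ∀ ha : a ≠ 0, Projectivization.mk ℂ a ha ∈ curve F → multAt F a b = 2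

/-- A bitangent meeting the curve only at smooth points. -/
def SmoothBitangent (F : MvPolynomial (Fin 3) ℂ) (S : Set P2) : Prop :=
  Bitangent F S ∧ ∀ p ∈ S ∩ curve F, ¬ IsSingularAt F p

theorem Derivation.aeval_eq_sum_pderiv {R σ A : Type*} [Fintype σ] [CommRing R] [CommRing A]
    [Algebra R A] (D : Derivation R A A) (g : σ → A) (F : MvPolynomial σ R) :
    D (aeval g F) = ∑ i, aeval g (pderiv i F) * D (g i) := by
  classical
  induction F using MvPolynomial.induction_on with
  | C a => simp
  | add p q hp hq => simp [hp, hq, add_mul, Finset.sum_add_distrib]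
  | mul_X p i hp =>
    simp only [map_mul, aeval_X, Derivation.leibniz, hp, smul_eq_mul, pderiv_X, map_add,
      add_mul, Finset.sum_add_distrib, Finset.mul_sum, Pi.single_apply]
    congr 1
    · rw [Finset.sum_eq_single i] <;> simp +contextual
      intro b hb; simp [Ne.symm hb]
    · refine Finset.sum_congr rfl fun j _ => by ring

theorem isHomogeneous_aeval_mul_left {R σ A : Type*} [CommRing R] [CommRing A]
    [Algebra R A] {F : MvPolynomial σ R} {n : ℕ} (hF : F.IsHomogeneous n) (t : A) (w : σ → A) :
    aeval (fun i => t * w i) F = t ^ n * aeval w F := by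
  simp only [aeval_def, eval₂_eq, Finset.mul_sum]
  refine Finset.sum_congr rfl fun d hd => ?_
  have h := hF (mem_support_iff.1 hd)
  simp only [mul_pow, Finset.prod_mul_distrib, Finset.prod_pow_eq_pow_sum]
  rw [Finsupp.weight_apply, Finsupp.sum] at h
  simp only [Pi.one_apply, smul_eq_mul, mul_one] at h
  rw [h]
  ring

theorem Squarefree.map_mulEquiv {M N : Type*} [CommMonoid M] [CommMonoid N] {x : M}
    (h : Squarefree x) (e : M ≃* N) : Squarefree (e x) := by
  intro y hy
  have h1 : e.symm y * e.symm y ∣ x := by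
    simpa using map_dvd e.symm hy
  simpa using (h _ h1).map e

theorem finSuccEquiv_pderiv_zero {R : Type*} [CommRing R] {n : ℕ}
    (F : MvPolynomial (Fin (n + 1)) R) :
    MvPolynomial.finSuccEquiv R n (pderiv 0 F) =
      Polynomial.derivative (MvPolynomial.finSuccEquiv R n F) := by
  induction F using MvPolynomial.induction_on with
  | C a => simp [finSuccEquiv_apply]
  | add p q hp hq => simp [hp, hq]
  | mul_X p i hp =>
    refine Fin.cases ?_ (fun j => ?_) i
    · simp [hp, pderiv_X, finSuccEquiv_X_zero]
      ring
    · simp [hp, pderiv_X, finSuccEquiv_X_succ]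
      ring

theorem finSuccEquiv_rename_succ {R : Type*} [CommRing R] {n : ℕ} (d : MvPolynomial (Fin n) R) :
    MvPolynomial.finSuccEquiv R n (rename Fin.succ d) = Polynomial.C d := by
  induction d using MvPolynomial.induction_on with
  | C a => simp [finSuccEquiv_apply]
  | add p q hp hq => simp [hp, hq]
  | mul_X p i hp => simp [hp, finSuccEquiv_X_succ]

theorem squarefree_map_fractionRing {R : Type*} [CommRing R] [IsDomain R]
    [UniqueFactorizationMonoid R] {G : Polynomial R} (hG : Squarefree G) :
    Squarefree (G.map (algebraMap R (FractionRing R))) := by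
  classical
  let _ : NormalizedGCDMonoid R := Classical.choice inferInstance
  intro g hg
  have hinj := IsFractionRing.injective R (FractionRing R)
  have hg0 : g ≠ 0 := by
    rintro rfl
    have hG0 := (Polynomial.map_ne_zero_iff hinj).2 hG.ne_zero
    exact hG0 (by simpa using hg)
  obtain ⟨b, hbm, hb⟩ := IsLocalization.integerNormalization_spec (nonZeroDivisors R) g
  set N := IsLocalization.integerNormalization (nonZeroDivisors R) g
  have hb0 : algebraMap R (FractionRing R) b ≠ 0 := by
    simpa using nonZeroDivisors.ne_zero hbm
  have hb' : N.map (algebraMap R (FractionRing R)) =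
      Polynomial.C (algebraMap R (FractionRing R) b) * g := by
    rw [hb, ← algebraMap_smul (FractionRing R) b g, Polynomial.smul_eq_C_mul]
  have hN0 : N ≠ 0 := by
    rintro h
    rw [h, Polynomial.map_zero] at hb'
    exact mul_ne_zero (Polynomial.C_ne_zero.2 hb0) hg0 hb'.symm
  have hc0 : algebraMap R (FractionRing R) N.content ≠ 0 := by
    simpa [Polynomial.content_eq_zero_iff] using hN0
  have hN : N.map (algebraMap R (FractionRing R)) =
      Polynomial.C (algebraMap R (FractionRing R) N.content) *
        N.primPart.map (algebraMap R (FractionRing R)) := by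
    conv_lhs => rw [N.eq_C_content_mul_primPart]
    simp
  have hassoc : Associated g (N.primPart.map (algebraMap R (FractionRing R))) := by
    have h1 : Associated g (Polynomial.C (algebraMap R (FractionRing R) b) * g) :=
      associated_unit_mul_right _ _ (Polynomial.isUnit_C.2 hb0.isUnit)
    rw [← hb', hN] at h1
    exact h1.trans (associated_unit_mul_left _ _ (Polynomial.isUnit_C.2 hc0.isUnit))
  have hdvd : N.primPart * N.primPart ∣ G := by
    refine (N.isPrimitive_primPart.mul N.isPrimitive_primPart).dvd_of_fraction_map_dvd_fraction_map
      (K := FractionRing R) ?_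
    rw [Polynomial.map_mul]
    exact ((hassoc.mul_mul hassoc).dvd_iff_dvd_left).1 hg
  exact hassoc.isUnit_iff.2 ((hG _ hdvd).map (Polynomial.mapRingHom _))

theorem exists_bezout_pderiv_zero {k : Type*} [Field k] [CharZero k] {n : ℕ}
    {G : MvPolynomial (Fin (n + 1)) k} (hG : Squarefree G) :
    ∃ A B : MvPolynomial (Fin (n + 1)) k, ∃ d : MvPolynomial (Fin n) k, d ≠ 0 ∧
      A * G + B * pderiv 0 G = rename Fin.succ d := by
  have h1 : Squarefree (MvPolynomial.finSuccEquiv k n G) :=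
    hG.map_mulEquiv (MvPolynomial.finSuccEquiv k n).toMulEquiv
  have : CharZero (FractionRing (MvPolynomial (Fin n) k)) :=
    charZero_of_injective_algebraMap (IsFractionRing.injective (MvPolynomial (Fin n) k) _)
  obtain ⟨u, v, huv⟩ :=
    (PerfectField.separable_iff_squarefree).2 (squarefree_map_fractionRing h1)
  obtain ⟨b, hbm, hb⟩ :=
    IsLocalization.integerNormalization_spec (nonZeroDivisors (MvPolynomial (Fin n) k)) u
  obtain ⟨c, hcm, hc⟩ :=
    IsLocalization.integerNormalization_spec (nonZeroDivisors (MvPolynomial (Fin n) k)) v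
  set U := IsLocalization.integerNormalization (nonZeroDivisors (MvPolynomial (Fin n) k)) u
  set V := IsLocalization.integerNormalization (nonZeroDivisors (MvPolynomial (Fin n) k)) v
  rw [← algebraMap_smul (FractionRing (MvPolynomial (Fin n) k)), Polynomial.smul_eq_C_mul] at hb hc
  have key : Polynomial.C c * U * MvPolynomial.finSuccEquiv k n G
      + Polynomial.C b * V * Polynomial.derivative (MvPolynomial.finSuccEquiv k n G)
      = Polynomial.C (b * c) := by
    apply Polynomial.map_injective _
      (IsFractionRing.injective (MvPolynomial (Fin n) k) (FractionRing (MvPolynomial (Fin n) k)))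
    rw [Polynomial.derivative_map] at huv
    simp only [Polynomial.map_add, Polynomial.map_mul, Polynomial.map_C, hb, hc, map_mul]
    linear_combination Polynomial.C (algebraMap (MvPolynomial (Fin n) k)
      (FractionRing (MvPolynomial (Fin n) k)) b) * Polynomial.C (algebraMap (MvPolynomial (Fin n) k)
      (FractionRing (MvPolynomial (Fin n) k)) c) * huv
  refine ⟨(MvPolynomial.finSuccEquiv k n).symm (Polynomial.C c * U),
    (MvPolynomial.finSuccEquiv k n).symm (Polynomial.C b * V), b * c,
    mul_ne_zero (nonZeroDivisors.ne_zero hbm) (nonZeroDivisors.ne_zero hcm), ?_⟩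
  apply (MvPolynomial.finSuccEquiv k n).injective
  rw [finSuccEquiv_rename_succ, ← key, map_add, map_mul _ _ G, map_mul _ _ (pderiv 0 G),
    AlgEquiv.apply_symm_apply, AlgEquiv.apply_symm_apply, finSuccEquiv_pderiv_zero]

theorem isAlgebraic_div_of_singular {L : Type*} [Field L] [Algebra ℂ L]
    {F : MvPolynomial (Fin 3) ℂ} {n : ℕ} (hF : F.IsHomogeneous n) (hsq : Squarefree F)
    (σ : Equiv.Perm (Fin 3)) (w : Fin 3 → L) (h0 : aeval w F = 0)
    (h : ∀ i, aeval w (pderiv i F) = 0) (hw : w (σ 2) ≠ 0) :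
    IsAlgebraic ℂ (w (σ 1) / w (σ 2)) := by
  by_contra htr
  set G := rename σ.symm F with hG
  have hGsq : Squarefree G := hsq.map_mulEquiv (renameEquiv ℂ σ.symm).toMulEquiv
  obtain ⟨A, B, d, hd, hAB⟩ := exists_bezout_pderiv_zero hGsq
  have hd' : d * X 1 ≠ 0 := mul_ne_zero hd (X_ne_zero _)
  obtain ⟨y, hy⟩ : ∃ y : Fin 2 → ℂ, eval y (d * X 1) ≠ 0 := by
    by_contra! hcon
    exact hd' (MvPolynomial.funext fun y => by simpa using hcon y)
  simp only [map_mul, eval_X, mul_ne_zero_iff] at hy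
  obtain ⟨hy0, hy1⟩ := hy
  set μ := y 1 with hμ
  set g : Polynomial ℂ := aeval ![Polynomial.C μ * Polynomial.X, Polynomial.C μ] d with hg
  have hg0 : g ≠ 0 := by
    intro hzero
    have h1 : Polynomial.aeval (y 0 / μ) g = 0 := by simp [hzero]
    rw [hg, MvPolynomial.comp_aeval_apply] at h1
    apply hy0
    rw [← MvPolynomial.coe_aeval_eq_eval, RingHom.coe_coe]
    convert h1 using 3
    ext i
    fin_cases i
    · simp [mul_div_cancel₀ _ hy1]
    · simp [hμ]
  apply htr
  refine ⟨g, hg0, ?_⟩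
  set t : L := algebraMap ℂ L μ / w (σ 2) with ht
  have hcomp : ∀ P : MvPolynomial (Fin 3) ℂ,
      aeval (fun i => t * w (σ i)) (rename σ.symm P) = aeval (fun i => t * w i) P := by
    intro P
    rw [aeval_rename]
    congr 2
    ext i
    simp
  have hG0 : aeval (fun i => t * w (σ i)) G = 0 := by
    rw [hG, hcomp, isHomogeneous_aeval_mul_left hF, h0, mul_zero]
  have hG1 : aeval (fun i => t * w (σ i)) (pderiv 0 G) = 0 := by
    have : pderiv 0 G = rename σ.symm (pderiv (σ 0) F) := by
      rw [hG, ← pderiv_rename σ.symm.injective]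
      simp
    rw [this, hcomp, isHomogeneous_aeval_mul_left hF.pderiv, h, mul_zero]
  have h2 := congrArg (aeval (fun i => t * w (σ i))) hAB
  simp only [map_add, map_mul, hG0, hG1, mul_zero, add_zero, aeval_rename] at h2
  rw [hg, MvPolynomial.comp_aeval_apply, h2]
  congr 2
  ext i
  fin_cases i
  · simp [ht]; field_simp
  · simp [ht, hw]

theorem mem_range_algebraMap_of_isAlgebraic {k L : Type*} [Field k] [IsAlgClosed k] [Field L]
    [Algebra k L] {x : L} (hx : IsAlgebraic k x) : x ∈ (algebraMap k L).range :=
  minpoly.mem_range_of_degree_eq_one _ _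
    (IsAlgClosed.degree_eq_one_of_irreducible _ (minpoly.irreducible hx.isIntegral))

/-- A singular point of a reduced plane curve over `ℂ`, with coordinates in an extension field,
is defined over `ℂ`. -/
theorem exists_eq_mul_algebraMap_of_singular {L : Type*} [Field L] [Algebra ℂ L]
    {F : MvPolynomial (Fin 3) ℂ} {n : ℕ} (hF : F.IsHomogeneous n) (hsq : Squarefree F)
    (w : Fin 3 → L) (h0 : aeval w F = 0) (h : ∀ i, aeval w (pderiv i F) = 0) :
    ∃ (t : L) (z : Fin 3 → ℂ), ∀ i, w i = t * algebraMap ℂ L (z i) := by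
  by_cases hw : ∀ i, w i = 0
  · exact ⟨0, 0, by simpa using hw⟩
  push Not at hw
  obtain ⟨j, hj⟩ := hw
  have key : ∀ i, ∃ z : ℂ, w i = w j * algebraMap ℂ L z := by
    intro i
    by_cases hij : i = j
    · exact ⟨1, by simp [hij]⟩
    have hσ : ∀ i j : Fin 3, i ≠ j → ∃ σ : Equiv.Perm (Fin 3), σ 1 = i ∧ σ 2 = j := by decide
    obtain ⟨σ, rfl, rfl⟩ := hσ i j hij
    have halg := isAlgebraic_div_of_singular hF hsq σ w h0 h hj
    obtain ⟨z, hz⟩ := mem_range_algebraMap_of_isAlgebraic halg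
    exact ⟨z, by rw [hz]; field_simp⟩
  choose z hz using key
  exact ⟨w j, z, hz⟩

/-- The derivation of `A[X]` acting as `D` on the coefficients. -/
def coeffDerivation {R A : Type*} [CommRing R] [CommRing A] [Algebra R A] (D : Derivation R A A) :
    Derivation R (Polynomial A) (Polynomial A) :=
  PolynomialModule.equivPolynomialSelf.toLinearMap.compDer D.mapCoeffs

theorem coeff_coeffDerivation {R A : Type*} [CommRing R] [CommRing A] [Algebra R A]
    (D : Derivation R A A) (p : Polynomial A) (i : ℕ) :
    (coeffDerivation D p).coeff i = D (p.coeff i) := rfl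

theorem coeffDerivation_C {R A : Type*} [CommRing R] [CommRing A] [Algebra R A]
    (D : Derivation R A A) (a : A) :
    coeffDerivation D (Polynomial.C a) = Polynomial.C (D a) := by
  ext i
  rw [coeff_coeffDerivation, Polynomial.coeff_C, Polynomial.coeff_C]
  split_ifs <;> simp

theorem coeffDerivation_X {R A : Type*} [CommRing R] [CommRing A] [Algebra R A]
    (D : Derivation R A A) : coeffDerivation D (Polynomial.X : Polynomial A) = 0 := by
  ext i
  rw [coeff_coeffDerivation, Polynomial.coeff_X]
  split_ifs <;> simp

/-- The restriction of a form `F` to the parametrized line `x ↦ u + x v`, over any algebra. -/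
def linePoly {R A : Type*} [CommRing R] [CommRing A] [Algebra R A] (F : MvPolynomial (Fin 3) R)
    (u v : Fin 3 → A) : Polynomial A :=
  aeval (fun i => Polynomial.C (u i) + Polynomial.X * Polynomial.C (v i)) F

theorem aeval_linePoly {R A B : Type*} [CommRing R] [CommRing A] [CommRing B] [Algebra R A]
    [Algebra A B] [Algebra R B] [IsScalarTower R A B] (F : MvPolynomial (Fin 3) R)
    (u v : Fin 3 → A) (x : B) :
    Polynomial.aeval x (linePoly F u v) =
      aeval (fun i => algebraMap A B (u i) + x * algebraMap A B (v i)) F := by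
  rw [linePoly, ← AlgHom.restrictScalars_apply R, MvPolynomial.comp_aeval_apply]
  simp [mul_comm x]

theorem eval_linePoly {R A : Type*} [CommRing R] [CommRing A] [Algebra R A]
    (F : MvPolynomial (Fin 3) R) (u v : Fin 3 → A) (x : A) :
    (linePoly F u v).eval x = aeval (fun i => u i + x * v i) F := by
  simpa using aeval_linePoly F u v x

theorem derivative_linePoly {R A : Type*} [CommRing R] [CommRing A] [Algebra R A]
    (F : MvPolynomial (Fin 3) R) (u v : Fin 3 → A) :
    Polynomial.derivative (linePoly F u v) =
      ∑ i, linePoly (pderiv i F) u v * Polynomial.C (v i) := by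
  have := Derivation.aeval_eq_sum_pderiv ((Polynomial.derivative' (R := A)).restrictScalars R)
    (fun i => Polynomial.C (u i) + Polynomial.X * Polynomial.C (v i)) F
  simpa [linePoly, Polynomial.derivative'] using this

theorem coeffDerivation_linePoly {R A : Type*} [CommRing R] [CommRing A] [Algebra R A]
    (D : Derivation R A A) (F : MvPolynomial (Fin 3) R) (u v : Fin 3 → A) :
    coeffDerivation D (linePoly F u v) = ∑ i, linePoly (pderiv i F) u v *
      (Polynomial.C (D (u i)) + Polynomial.X * Polynomial.C (D (v i))) := by
  rw [linePoly, Derivation.aeval_eq_sum_pderiv]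
  simp [linePoly, coeffDerivation_C, coeffDerivation_X]

theorem aeval_euler {R A : Type*} [CommRing R] [CommRing A] [Algebra R A]
    {F : MvPolynomial (Fin 3) R} {n : ℕ} (hF : F.IsHomogeneous n) (w : Fin 3 → A) :
    w 0 * aeval w (pderiv 0 F) + w 1 * aeval w (pderiv 1 F) + w 2 * aeval w (pderiv 2 F) =
      n * aeval w F := by
  have := congrArg (aeval w) hF.sum_X_mul_pderiv
  simpa [Fin.sum_univ_three] using this

theorem constant_of_singular_on_line {L : Type*} [Field L] [Algebra ℂ L]
    {F : MvPolynomial (Fin 3) ℂ} {d : ℕ} (hF : F.IsHomogeneous d) (hsq : Squarefree F)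
    (α : ℂ) (c n ρ : L) (w : Fin 3 → L)
    (hw : w = ![1 + ρ * algebraMap ℂ L α, ρ, c + ρ * n])
    (h0 : aeval w F = 0) (h2 : aeval w (pderiv 2 F) = 0)
    (h1 : algebraMap ℂ L α * aeval w (pderiv 0 F) + aeval w (pderiv 1 F)
      + n * aeval w (pderiv 2 F) = 0) :
    ∃ r s : ℂ, algebraMap ℂ L r = ρ ∧ algebraMap ℂ L s = c + ρ * n ∧
      ∀ i, aeval w (pderiv i F) = 0 := by
  have hE := aeval_euler hF w
  rw [h0, h2] at hE
  rw [h2] at h1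
  have e0 : w 0 = 1 + ρ * algebraMap ℂ L α := by simp [hw]
  have e1 : w 1 = ρ := by simp [hw]
  have e2 : w 2 = c + ρ * n := by simp [hw]
  have hp0 : aeval w (pderiv 0 F) = 0 := by
    rw [e0, e1] at hE
    linear_combination hE - ρ * h1
  have hp1 : aeval w (pderiv 1 F) = 0 := by
    rw [hp0] at h1
    linear_combination h1
  have hgrad : ∀ i, aeval w (pderiv i F) = 0 := by
    intro i
    fin_cases i
    · exact hp0
    · exact hp1
    · exact h2
  obtain ⟨t, z, hz⟩ := exists_eq_mul_algebraMap_of_singular hF hsq w h0 hgrad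
  have ht : t * algebraMap ℂ L (z 0 - α * z 1) = 1 := by
    have hz0 := hz 0
    have hz1 := hz 1
    rw [e0] at hz0
    rw [e1] at hz1
    rw [map_sub, map_mul]
    linear_combination -hz0 + algebraMap ℂ L α * hz1
  have ht' : t = algebraMap ℂ L (z 0 - α * z 1)⁻¹ := by
    rw [map_inv₀]
    exact eq_inv_of_mul_eq_one_left ht
  refine ⟨(z 0 - α * z 1)⁻¹ * z 1, (z 0 - α * z 1)⁻¹ * z 2, ?_, ?_, hgrad⟩
  · rw [map_mul, ← ht', ← hz 1, e1]
  · rw [map_mul, ← ht', ← hz 2, e2]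

theorem linePoly_ne_zero {K : Type*} [Field K] [Algebra ℂ K] (D : Derivation ℂ K K)
    {F : MvPolynomial (Fin 3) ℂ} {d : ℕ} (hF : F.IsHomogeneous d) (hsq : Squarefree F)
    (c m : K) (hD : D c ≠ 0 ∨ D m ≠ 0) : linePoly F ![1, 0, c] ![0, 1, m] ≠ 0 := by
  intro hf
  have h1 := coeffDerivation_linePoly D F ![1, 0, c] ![0, 1, m]
  have h2 := derivative_linePoly F ![1, 0, c] ![0, 1, m]
  simp only [hf, map_zero, Fin.sum_univ_three, Matrix.cons_val, Derivation.map_one_eq_zero,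
    mul_zero, add_zero, zero_add, map_one, mul_one] at h1 h2
  have h3 : linePoly (pderiv 2 F) ![1, 0, c] ![0, 1, m] = 0 := by
    refine (mul_eq_zero.1 h1.symm).resolve_right fun h => ?_
    have hc := congrArg (fun p => Polynomial.coeff p 0) h
    have hm := congrArg (fun p => Polynomial.coeff p 1) h
    simp [Polynomial.coeff_C] at hc hm
    tauto
  have key : ∀ ρ : K, ∃ s : ℂ, algebraMap ℂ K s = c + ρ * m := by
    intro ρ
    have hw : (fun i => (![1, 0, c] : Fin 3 → K) i + ρ * (![0, 1, m] : Fin 3 → K) i) =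
        ![1 + ρ * algebraMap ℂ K 0, ρ, c + ρ * m] := by
      ext i
      fin_cases i <;> simp
    have g0 := congrArg (Polynomial.eval ρ) hf
    have g1 := congrArg (Polynomial.eval ρ) h2
    have g3 := congrArg (Polynomial.eval ρ) h3
    simp only [Polynomial.eval_add, Polynomial.eval_mul, Polynomial.eval_C, eval_linePoly,
      Polynomial.eval_zero] at g0 g1 g3
    obtain ⟨-, s, -, hs, -⟩ := constant_of_singular_on_line hF hsq 0 c m ρ _ hw g0 g3
      (by rw [map_zero]; linear_combination -g1)
    exact ⟨s, hs⟩
  obtain ⟨s, hs⟩ := key 0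
  obtain ⟨t, ht⟩ := key 1
  have hc : D c = 0 := by
    rw [show c = algebraMap ℂ K s by rw [hs]; ring, Derivation.map_algebraMap]
  have hm : D m = 0 := by
    rw [show m = algebraMap ℂ K (t - s) by rw [map_sub, hs, ht]; ring, Derivation.map_algebraMap]
  tauto

theorem pderiv_pderiv_comm {R σ : Type*} [CommRing R] (i j : σ) (F : MvPolynomial σ R) :
    pderiv i (pderiv j F) = pderiv j (pderiv i F) := by
  classical
  have h : ⁅(pderiv i : Derivation R (MvPolynomial σ R) (MvPolynomial σ R)),
      (pderiv j : Derivation R (MvPolynomial σ R) (MvPolynomial σ R))⁆ = 0 := by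
    refine MvPolynomial.derivation_ext fun k => ?_
    rw [Derivation.commutator_apply, pderiv_X, pderiv_X, Pi.single_apply, Pi.single_apply]
    split_ifs <;> simp
  have := congrArg (fun d => d F) h
  simpa [Derivation.commutator_apply, sub_eq_zero] using this

theorem eq_zero_of_quadratic_eq_zero {K : Type*} [Field K] [Algebra ℂ K] (D : Derivation ℂ K K)
    {n : K} (hn : D n ≠ 0) {a b c : ℂ}
    (h : algebraMap ℂ K a + algebraMap ℂ K b * n + algebraMap ℂ K c * n ^ 2 = 0) :
    a = 0 ∧ b = 0 ∧ c = 0 := by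
  have := charZero_of_injective_algebraMap (algebraMap ℂ K).injective
  have h1 := congrArg D h
  simp only [map_add, Derivation.leibniz, Derivation.map_algebraMap, map_zero, smul_eq_mul,
    pow_two, mul_zero, add_zero, zero_add] at h1
  have h2 : algebraMap ℂ K b + algebraMap ℂ K c * (n + n) = 0 := by
    refine (mul_eq_zero.1 (?_ : D n * _ = 0)).resolve_left hn
    linear_combination h1
  have h3 := congrArg D h2
  simp only [map_add, Derivation.leibniz, Derivation.map_algebraMap, map_zero, smul_eq_mul,
    mul_zero, add_zero, zero_add] at h3
  have hc : algebraMap ℂ K c = 0 := by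
    simpa [hn, ← two_mul] using h3
  rw [hc] at h2 h
  have hb : algebraMap ℂ K b = 0 := by simpa using h2
  rw [hb] at h
  have ha : algebraMap ℂ K a = 0 := by simpa using h
  rw [map_eq_zero] at ha hb hc
  exact ⟨ha, hb, hc⟩

theorem hessian_eq_zero (H : Fin 3 → Fin 3 → ℂ) (hsymm : ∀ i j, H i j = H j i) (z : Fin 3 → ℂ)
    (α : ℂ) (hz : z 0 - α * z 1 = 1)
    (hker : ∀ i, z 0 * H 0 i + z 1 * H 1 i + z 2 * H 2 i = 0)
    (h22 : H 2 2 = 0) (h02 : α * H 0 2 + H 1 2 = 0)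
    (h00 : α ^ 2 * H 0 0 + 2 * α * H 0 1 + H 1 1 = 0) : ∀ i j, H i j = 0 := by
  have s1 := hsymm 1 0
  have s2 := hsymm 2 0
  have s3 := hsymm 2 1
  have k0 := hker 0
  have k1 := hker 1
  have k2 := hker 2
  have e02 : H 0 2 = 0 := by
    linear_combination -H 0 2 * hz + k2 - z 2 * h22 - z 1 * h02
  have e12 : H 1 2 = 0 := by linear_combination h02 - α * e02
  have e20 : H 2 0 = 0 := by rw [s2, e02]
  have e21 : H 2 1 = 0 := by rw [s3, e12]
  rw [e20, s1] at k0
  rw [e21] at k1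
  have e01 : α * H 0 0 + H 0 1 = 0 := by
    linear_combination -(α * H 0 0 + H 0 1) * hz + α * k0 + k1 - z 1 * h00
  have e00 : H 0 0 = 0 := by
    linear_combination - H 0 0 * hz + k0 - z 1 * e01
  have e01' : H 0 1 = 0 := by linear_combination e01 - α * e00
  have e11 : H 1 1 = 0 := by linear_combination h00 - α ^ 2 * e00 - 2 * α * e01'
  have e10 : H 1 0 = 0 := by rw [s1, e01']
  intro i j
  fin_cases i <;> fin_cases j <;> assumption

theorem linePoly_ne_const_mul_sq {K : Type*} [Field K] [Algebra ℂ K] (D : Derivation ℂ K K)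
    {F : MvPolynomial (Fin 3) ℂ} (hF : F.IsHomogeneous 4) (hsq : Squarefree F)
    (hquad : ∀ z : Fin 3 → ℂ, z ≠ 0 → ∃ i j, eval z (pderiv i (pderiv j F)) ≠ 0)
    (α : ℂ) (c n : K) (hD : D c ≠ 0 ∨ D n ≠ 0) (a p s : K)
    (hf : linePoly F ![1, 0, c] ![algebraMap ℂ K α, 1, n] = Polynomial.C a *
      (Polynomial.X ^ 2 + Polynomial.C p * Polynomial.X + Polynomial.C s) ^ 2) : False := by
  have hchar := charZero_of_injective_algebraMap (algebraMap ℂ K).injective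
  set u : Fin 3 → K := ![1, 0, c] with hu
  set v : Fin 3 → K := ![algebraMap ℂ K α, 1, n] with hv
  set q : Polynomial K := Polynomial.X ^ 2 + Polynomial.C p * Polynomial.X + Polynomial.C s with hq
  have h1 : coeffDerivation D (linePoly F u v) = linePoly (pderiv 2 F) u v *
      (Polynomial.C (D c) + Polynomial.X * Polynomial.C (D n)) := by
    rw [coeffDerivation_linePoly]
    simp [hu, hv, Fin.sum_univ_three]
  have h2 : Polynomial.derivative (linePoly F u v) =
      linePoly (pderiv 0 F) u v * Polynomial.C (algebraMap ℂ K α) + linePoly (pderiv 1 F) u v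
        + linePoly (pderiv 2 F) u v * Polynomial.C n := by
    rw [derivative_linePoly]
    simp [hv, Fin.sum_univ_three]
  have h3 : coeffDerivation D (linePoly F u v) =
      Polynomial.C (D a) * q ^ 2 + 2 * Polynomial.C a * q * coeffDerivation D q := by
    rw [hf, Derivation.leibniz, coeffDerivation_C, pow_two, Derivation.leibniz]
    simp only [smul_eq_mul]
    ring
  have hroot : ∀ ρ : AlgebraicClosure K, Polynomial.aeval ρ q = 0 →
      algebraMap K (AlgebraicClosure K) (D c) + ρ * algebraMap K (AlgebraicClosure K) (D n)
        = 0 := by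
    intro ρ hρ
    by_contra hne
    have hw : (fun i => algebraMap K (AlgebraicClosure K) (u i)
        + ρ * algebraMap K (AlgebraicClosure K) (v i)) =
        ![1 + ρ * algebraMap ℂ (AlgebraicClosure K) α, ρ,
          algebraMap K (AlgebraicClosure K) c + ρ * algebraMap K (AlgebraicClosure K) n] := by
      ext i
      fin_cases i <;> simp [hu, hv, ← IsScalarTower.algebraMap_apply]
    have g0 := congrArg (Polynomial.aeval ρ) hf
    have g1 := congrArg (Polynomial.aeval ρ) (h1.symm.trans h3)
    have g2 := congrArg (Polynomial.aeval ρ) h2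
    rw [hf] at g2
    simp only [map_mul, map_add, map_pow, Polynomial.derivative_mul, Polynomial.derivative_C,
      Polynomial.derivative_pow, hρ, aeval_linePoly, Polynomial.aeval_C, Polynomial.aeval_X,
      ← IsScalarTower.algebraMap_apply ℂ K] at g0 g1 g2
    norm_num at g0 g1 g2
    have g1' := g1.resolve_right hne
    obtain ⟨r, t, hr, ht, -⟩ := constant_of_singular_on_line hF hsq α
      (algebraMap K (AlgebraicClosure K) c) (algebraMap K (AlgebraicClosure K) n) ρ _ hw
      g0 g1' (by linear_combination -g2)
    apply hne
    rw [IsScalarTower.algebraMap_apply ℂ K] at hr ht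
    have ht' : algebraMap ℂ K t = c + algebraMap ℂ K r * n := by
      apply (algebraMap K (AlgebraicClosure K)).injective
      rw [ht, ← hr, map_add, map_mul]
    have ht'' := congrArg D ht'
    simp only [map_add, Derivation.leibniz, Derivation.map_algebraMap, smul_eq_mul, mul_zero,
      add_zero] at ht''
    rw [← hr, ← map_mul, ← map_add, ← ht'', map_zero]
  have hdeg : q.natDegree = 2 := by
    rw [hq]; compute_degree!
  obtain ⟨ρ, hρ⟩ := IsAlgClosed.exists_aeval_eq_zero (AlgebraicClosure K) q (by
    intro h
    have := Polynomial.natDegree_eq_zero_iff_degree_le_zero.2 h.le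
    omega)
  have hρ' : Polynomial.aeval (-algebraMap K (AlgebraicClosure K) p - ρ) q = 0 := by
    rw [← hρ, hq]
    simp
    ring
  have l1 := hroot _ hρ
  have l2 := hroot _ hρ'
  have hn : D n ≠ 0 := by
    intro h0
    simp [h0] at l1
    tauto
  have hn' : algebraMap K (AlgebraicClosure K) (D n) ≠ 0 := by simpa using hn
  have hρe : ρ = algebraMap K (AlgebraicClosure K) (-D c / D n) := by
    rw [map_div₀, map_neg]
    field_simp
    linear_combination l1
  set r₀ : K := -D c / D n with hr₀
  have hp : p = - 2 * r₀ := by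
    apply (algebraMap K (AlgebraicClosure K)).injective
    rw [hρe] at l1 l2
    apply mul_right_cancel₀ hn'
    simp only [map_mul, map_neg, map_ofNat]
    linear_combination l1 - l2
  have hqr : q.eval r₀ = 0 := by
    apply (algebraMap K (AlgebraicClosure K)).injective
    rw [map_zero, ← hρ, hρe, Polynomial.aeval_algebraMap_apply, Polynomial.coe_aeval_eq_eval]
  have hqr' : (Polynomial.derivative q).eval r₀ = 0 := by
    simp [hq, hp]
    ring
  have hF2 : (linePoly (pderiv 2 F) u v).eval r₀ = 0 := by
    have g := congrArg (fun f => (Polynomial.derivative f).eval r₀) (h1.symm.trans h3)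
    have hl : D c + D n * r₀ = 0 := by rw [hr₀]; field_simp; ring
    simp [hqr, hqr', pow_two] at g
    rw [hl, mul_zero, zero_add] at g
    exact (mul_eq_zero.1 g).resolve_right hn
  have hw : (fun i => u i + r₀ * v i) = ![1 + r₀ * algebraMap ℂ K α, r₀, c + r₀ * n] := by
    ext i
    fin_cases i <;> simp [hu, hv]
  have hf0 : (linePoly F u v).eval r₀ = 0 := by simp [hf, hqr]
  have hf1 : (Polynomial.derivative (linePoly F u v)).eval r₀ = 0 := by simp [hf, hqr, pow_two]
  have hf2 : (Polynomial.derivative (Polynomial.derivative (linePoly F u v))).eval r₀ = 0 := by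
    simp [hf, hqr, hqr', pow_two]
  rw [h2] at hf1 hf2
  simp only [Polynomial.eval_add, Polynomial.eval_mul, Polynomial.eval_C, eval_linePoly]
    at hf0 hf1 hF2
  obtain ⟨r, t, hr, ht, hgrad⟩ := constant_of_singular_on_line hF hsq α c n r₀ _ hw hf0 hF2
    (by linear_combination hf1)
  set z : Fin 3 → ℂ := ![1 + r * α, r, t] with hz
  have hwz : (fun i => u i + r₀ * v i) = fun i => algebraMap ℂ K (z i) := by
    rw [hw]
    ext i
    fin_cases i <;> simp [hz, hr, ht]
  have hevC : ∀ G : MvPolynomial (Fin 3) ℂ, aeval z G = eval z G := by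
    intro G
    rw [← MvPolynomial.coe_aeval_eq_eval, RingHom.coe_coe]
  have hev : ∀ G : MvPolynomial (Fin 3) ℂ,
      aeval (fun i => algebraMap ℂ K (z i)) G = algebraMap ℂ K (eval z G) := by
    intro G
    rw [← hevC]
    exact MvPolynomial.aeval_algebraMap_apply K z G
  have hgrad' : ∀ i, eval z (pderiv i F) = 0 := by
    intro i
    have := hgrad i
    rwa [hwz, hev, map_eq_zero] at this
  have hz1 : z 0 - α * z 1 = 1 := by
    simp [hz]; ring
  have hzero := hessian_eq_zero (fun i j => eval z (pderiv i (pderiv j F)))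
    (fun i j => by rw [pderiv_pderiv_comm]) z α hz1 (fun i => by
      have := aeval_euler (hF.pderiv (i := i)) z
      simp only [hevC, hgrad', mul_zero] at this
      exact this)
  simp only [derivative_linePoly, Polynomial.derivative_add, Polynomial.derivative_mul,
    Polynomial.derivative_C, mul_zero, add_zero, Polynomial.eval_add, Polynomial.eval_mul,
    Polynomial.eval_C, Fin.sum_univ_three, eval_linePoly, hwz, hev] at hf2
  simp only [hv, Matrix.cons_val] at hf2
  rw [pderiv_pderiv_comm 1 0, pderiv_pderiv_comm 2 0, pderiv_pderiv_comm 2 1] at hf2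
  obtain ⟨q1, q2, q3⟩ := eq_zero_of_quadratic_eq_zero D hn
    (a := α ^ 2 * eval z (pderiv 0 (pderiv 0 F)) + 2 * α * eval z (pderiv 0 (pderiv 1 F)) +
      eval z (pderiv 1 (pderiv 1 F)))
    (b := 2 * (α * eval z (pderiv 0 (pderiv 2 F)) + eval z (pderiv 1 (pderiv 2 F))))
    (c := eval z (pderiv 2 (pderiv 2 F))) (by
      simp only [map_add, map_mul, map_pow, map_ofNat]
      linear_combination hf2)
  have hz0 : z ≠ 0 := by
    intro h
    simp [h] at hz1
  obtain ⟨i, j, hij⟩ := hquad z hz0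
  exact hij (hzero q3 (by simpa using q2) q1 i j)

theorem exists_derivation_ne_zero {k K : Type} [Field k] [Field K] [CharZero k] [IsAlgClosed k]
    [Algebra k K] [Algebra.EssFiniteType k K] {x : K} (hx : x ∉ (algebraMap k K).range) :
    ∃ D : Derivation k K K, D ≠ 0 := by
  by_contra! hD
  have hsub : Subsingleton (Ω[K⁄k]) := by
    rw [← Module.subsingleton_dual_iff K]
    refine ⟨fun f g => (KaehlerDifferential.linearMapEquivDerivation k K).injective ?_⟩
    rw [hD (KaehlerDifferential.linearMapEquivDerivation k K f),
      hD (KaehlerDifferential.linearMapEquivDerivation k K g)]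
  have hunr : Algebra.FormallyUnramified k K := ⟨hsub⟩
  rw [Algebra.FormallyUnramified.iff_isSeparable] at hunr
  exact hx (mem_range_algebraMap_of_isAlgebraic (Algebra.IsAlgebraic.isAlgebraic x))

theorem exists_derivation_adjoin_pair {k L : Type} [Field k] [Field L] [CharZero k]
    [IsAlgClosed k] [Algebra k L] (x y : L)
    (hxy : x ∉ (algebraMap k L).range ∨ y ∉ (algebraMap k L).range) :
    ∃ (K : Type) (_ : Field K) (_ : Algebra k K) (ι : K →ₐ[k] L) (x' y' : K)
      (D : Derivation k K K), ι x' = x ∧ ι y' = y ∧ (D x' ≠ 0 ∨ D y' ≠ 0) := by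
  classical
  let K := IntermediateField.adjoin k ({x, y} : Set L)
  have hx : x ∈ K := IntermediateField.subset_adjoin _ _ (by simp)
  have hy : y ∈ K := IntermediateField.subset_adjoin _ _ (by simp)
  have : Algebra.EssFiniteType k K :=
    IntermediateField.essFiniteType_iff.2 ⟨{x, y}, by simp [K]⟩
  obtain ⟨z, hz⟩ : ∃ z : K, z ∉ (algebraMap k K).range := by
    rcases hxy with h | h
    · exact ⟨⟨x, hx⟩, fun ⟨a, ha⟩ => h ⟨a, congrArg Subtype.val ha⟩⟩
    · exact ⟨⟨y, hy⟩, fun ⟨a, ha⟩ => h ⟨a, congrArg Subtype.val ha⟩⟩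
  obtain ⟨D, hD⟩ := exists_derivation_ne_zero hz
  refine ⟨K, inferInstance, inferInstance, K.val, ⟨x, hx⟩, ⟨y, hy⟩, D, rfl, rfl, ?_⟩
  by_contra! h
  apply hD
  ext ⟨w, hw⟩
  suffices hw' : D ⟨w, hw⟩ = 0 by rw [hw']; rfl
  induction hw using IntermediateField.adjoin_induction with
  | mem a ha =>
    rcases ha with rfl | rfl
    · exact h.1
    · exact h.2
  | algebraMap a => exact D.map_algebraMap a
  | add a b ha hb iha ihb =>
    have := D.map_add ⟨a, ha⟩ ⟨b, hb⟩
    rw [iha, ihb, add_zero] at this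
    exact this
  | mul a b ha hb iha ihb =>
    have := D.leibniz ⟨a, ha⟩ ⟨b, hb⟩
    rw [iha, ihb, smul_zero, smul_zero, add_zero] at this
    exact this
  | inv a ha iha =>
    have := D.leibniz_inv ⟨a, ha⟩
    rw [iha, smul_zero] at this
    exact this

theorem exists_algHom_of_infinite {k : Type} [Field k] {T : Set (k × k)} (hT : T.Infinite) :
    ∃ (L : Type) (_ : Field L) (_ : Algebra k L) (φ : (T → k) →ₐ[k] L),
      φ (fun t => t.1.1) ∉ (algebraMap k L).range ∨
        φ (fun t => t.1.2) ∉ (algebraMap k L).range := by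
  have : Infinite T := hT.to_subtype
  let U : Ultrafilter T := Filter.hyperfilter T
  let algL : Algebra k (Filter.Germ (U : Filter T) k) :=
    ((Filter.Germ.coeRingHom (R := k) (U : Filter T)).comp (Pi.constRingHom T k)).toAlgebra
  refine ⟨Filter.Germ (U : Filter T) k, inferInstance, algL,
    { Filter.Germ.coeRingHom (R := k) (U : Filter T) with commutes' := fun _ => rfl }, ?_⟩
  by_contra! h
  obtain ⟨⟨a, ha⟩, ⟨b, hb⟩⟩ := h
  have ha' : ∀ᶠ t : T in U, a = t.1.1 := Filter.Germ.coe_eq.1 ha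
  have hb' : ∀ᶠ t : T in U, b = t.1.2 := Filter.Germ.coe_eq.1 hb
  have hfin : {t : T | a = t.1.1 ∧ b = t.1.2}.Finite :=
    Set.Subsingleton.finite fun s hs t ht =>
      Subtype.ext (Prod.ext (hs.1.symm.trans ht.1) (hs.2.symm.trans ht.2))
  exact hfin.notMem_hyperfilter (ha'.and hb')

theorem map_linePoly {R A B : Type*} [CommRing R] [CommRing A] [CommRing B] [Algebra R A]
    [Algebra R B] (φ : A →ₐ[R] B) (F : MvPolynomial (Fin 3) R) (u v : Fin 3 → A) :
    (linePoly F u v).map (φ : A →+* B) = linePoly F (φ ∘ u) (φ ∘ v) := by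
  rw [linePoly, linePoly, ← Polynomial.coe_mapAlgHom, MvPolynomial.comp_aeval_apply]
  simp

theorem linePoly_natDegree_le_and_coeff {R A : Type*} [CommRing R] [CommRing A] [Algebra R A]
    {F : MvPolynomial (Fin 3) R} {n : ℕ} (hF : F.IsHomogeneous n) (u v : Fin 3 → A) :
    (linePoly F u v).natDegree ≤ n ∧ (linePoly F u v).coeff n = aeval v F := by
  have hlin : ∀ i, (Polynomial.C (u i) + Polynomial.X * Polynomial.C (v i)).natDegree ≤ 1 := by
    intro i
    compute_degree
  have hmon : ∀ s ∈ F.support,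
      (algebraMap R (Polynomial A) (coeff s F) * ∏ i : Fin 3,
        (Polynomial.C (u i) + Polynomial.X * Polynomial.C (v i)) ^ s i).natDegree ≤ n ∧
      (algebraMap R (Polynomial A) (coeff s F) * ∏ i : Fin 3,
        (Polynomial.C (u i) + Polynomial.X * Polynomial.C (v i)) ^ s i).coeff n =
        algebraMap R A (coeff s F) * ∏ i : Fin 3, v i ^ s i := by
    intro s hs
    have hsn : s 0 + s 1 + s 2 = n := by
      have := hF (mem_support_iff.1 hs)
      rwa [Finsupp.weight_apply, Finsupp.sum_fintype _ _ (by simp), Fin.sum_univ_three,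
        Pi.one_apply, Pi.one_apply, Pi.one_apply, smul_eq_mul, smul_eq_mul, smul_eq_mul,
        mul_one, mul_one, mul_one] at this
    have hpow : ∀ i, ((Polynomial.C (u i) + Polynomial.X * Polynomial.C (v i)) ^ s i).natDegree
        ≤ s i := fun i => by
      simpa using Polynomial.natDegree_pow_le_of_le (s i) (hlin i)
    have hcoeff : ∀ i, ((Polynomial.C (u i) + Polynomial.X * Polynomial.C (v i)) ^ s i).coeff
        (s i) = v i ^ s i := fun i => by
      simpa using Polynomial.coeff_pow_of_natDegree_le (m := s i) (hlin i)
    have h01 := Polynomial.natDegree_mul_le_of_le (hpow 0) (hpow 1)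
    have h012 := Polynomial.natDegree_mul_le_of_le h01 (hpow 2)
    rw [Fin.prod_univ_three, Fin.prod_univ_three, Polynomial.algebraMap_apply, ← hsn]
    refine ⟨(Polynomial.natDegree_C_mul_le _ _).trans h012, ?_⟩
    rw [Polynomial.coeff_C_mul, Polynomial.coeff_mul_add_eq_of_natDegree_le h01 (hpow 2),
      Polynomial.coeff_mul_add_eq_of_natDegree_le (hpow 0) (hpow 1), hcoeff, hcoeff, hcoeff]
  constructor
  · rw [linePoly, aeval_def, eval₂_eq']
    exact Polynomial.natDegree_sum_le_of_forall_le _ _ fun s hs => (hmon s hs).1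
  · rw [linePoly, aeval_def, aeval_def, eval₂_eq', eval₂_eq', Polynomial.finsetSum_coeff]
    exact Finset.sum_congr rfl fun s hs => (hmon s hs).2

/-- Over a field, for a polynomial of degree exactly four, this expresses being a constant times
a square. It holds trivially when the coefficient of `X ^ 4` vanishes. -/
def SquareCond {A : Type*} [CommRing A] (f : Polynomial A) : Prop :=
  f.coeff 4 * (8 * f.coeff 4 ^ 2 * f.coeff 1 -
      f.coeff 3 * (4 * f.coeff 4 * f.coeff 2 - f.coeff 3 ^ 2)) = 0 ∧
    f.coeff 4 * (64 * f.coeff 4 ^ 3 * f.coeff 0 -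
      (4 * f.coeff 4 * f.coeff 2 - f.coeff 3 ^ 2) ^ 2) = 0

theorem SquareCond.map {A B : Type*} [CommRing A] [CommRing B] (φ : A →+* B) {f : Polynomial A}
    (hf : SquareCond f) : SquareCond (f.map φ) := by
  have h1 := congrArg φ hf.1
  have h2 := congrArg φ hf.2
  simp only [map_mul, map_sub, map_pow, map_ofNat, map_zero] at h1 h2
  simpa only [SquareCond, Polynomial.coeff_map] using And.intro h1 h2

theorem SquareCond.of_map {A B : Type*} [CommRing A] [CommRing B] {φ : A →+* B}
    (hφ : Function.Injective φ) {f : Polynomial A} (hf : SquareCond (f.map φ)) :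
    SquareCond f := by
  obtain ⟨h1, h2⟩ := hf
  simp only [Polynomial.coeff_map] at h1 h2
  constructor <;> apply hφ <;>
    simpa only [map_mul, map_sub, map_pow, map_ofNat, map_zero]

theorem squareCond_pi {ι A : Type*} [CommRing A] {f : Polynomial (ι → A)}
    (hf : ∀ i, SquareCond (f.map (Pi.evalRingHom (fun _ => A) i))) : SquareCond f := by
  constructor <;> ext i
  · have := (hf i).1
    simp only [Polynomial.coeff_map] at this
    exact this
  · have := (hf i).2
    simp only [Polynomial.coeff_map] at this
    exact this

theorem SquareCond.exists_eq_sq {K : Type*} [Field K] [CharZero K] {f : Polynomial K}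
    (hf : SquareCond f) (hdeg : f.natDegree ≤ 4) (h4 : f.coeff 4 ≠ 0) :
    ∃ a p s : K, f = Polynomial.C a *
      (Polynomial.X ^ 2 + Polynomial.C p * Polynomial.X + Polynomial.C s) ^ 2 := by
  obtain ⟨h1, h2⟩ := hf
  have h1 := (mul_eq_zero.1 h1).resolve_left h4
  have h2 := (mul_eq_zero.1 h2).resolve_left h4
  have hsum := f.as_sum_range_C_mul_X_pow' (Nat.lt_succ_of_le hdeg)
  simp only [Finset.sum_range_succ, Finset.sum_range_zero] at hsum
  generalize f.coeff 4 = a at *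
  generalize f.coeff 3 = b at *
  generalize f.coeff 2 = c at *
  generalize f.coeff 1 = d at *
  generalize f.coeff 0 = e at *
  obtain ⟨p, rfl⟩ : ∃ p, b = 2 * a * p := ⟨b / (2 * a), by field_simp⟩
  obtain ⟨s, rfl⟩ : ∃ s, c = a * (p ^ 2 + 2 * s) := ⟨(c / a - p ^ 2) / 2, by field_simp; ring⟩
  have hd : d = 2 * a * p * s := by
    apply mul_left_cancel₀ (mul_ne_zero (by norm_num : (8 : K) ≠ 0) (pow_ne_zero 2 h4))
    linear_combination h1
  have he : e = a * s ^ 2 := by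
    apply mul_left_cancel₀ (mul_ne_zero (by norm_num : (64 : K) ≠ 0) (pow_ne_zero 3 h4))
    linear_combination h2
  refine ⟨a, p, s, ?_⟩
  rw [hsum, hd, he]
  simp only [map_mul, map_add, map_pow, map_ofNat]
  ring

theorem squareCond_const_mul_sq {A : Type*} [CommRing A] (a p s : A) :
    SquareCond (Polynomial.C a *
      (Polynomial.X ^ 2 + Polynomial.C p * Polynomial.X + Polynomial.C s) ^ 2) := by
  have h : Polynomial.C a *
      (Polynomial.X ^ 2 + Polynomial.C p * Polynomial.X + Polynomial.C s) ^ 2 =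
      Polynomial.C a * Polynomial.X ^ 4 + Polynomial.C (2 * a * p) * Polynomial.X ^ 3 +
      Polynomial.C (a * (p ^ 2 + 2 * s)) * Polynomial.X ^ 2 +
      Polynomial.C (2 * a * p * s) * Polynomial.X + Polynomial.C (a * s ^ 2) := by
    simp only [map_mul, map_add, map_pow, map_ofNat]
    ring
  have hcoeff : ∀ a b c d e : A, SquareCond (Polynomial.C a * Polynomial.X ^ 4 +
      Polynomial.C b * Polynomial.X ^ 3 + Polynomial.C c * Polynomial.X ^ 2 +
      Polynomial.C d * Polynomial.X + Polynomial.C e) =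
      (a * (8 * a ^ 2 * d - b * (4 * a * c - b ^ 2)) = 0 ∧
        a * (64 * a ^ 3 * e - (4 * a * c - b ^ 2) ^ 2) = 0) := by
    intro a b c d e
    simp [SquareCond, Polynomial.coeff_X, Polynomial.coeff_C]
  rw [h, hcoeff]
  constructor <;> ring

theorem finite_squareCond {F : MvPolynomial (Fin 3) ℂ} (hF : F.IsHomogeneous 4)
    (hsq : Squarefree F)
    (hquad : ∀ z : Fin 3 → ℂ, z ≠ 0 → ∃ i j, eval z (pderiv i (pderiv j F)) ≠ 0) :
    {t : ℂ × ℂ | ∀ α : ℂ,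
      SquareCond (linePoly F ![1, 0, t.1] ![α, 1, t.2 + α * t.1])}.Finite := by
  by_contra hT
  set T := {t : ℂ × ℂ | ∀ α : ℂ,
      SquareCond (linePoly F ![1, 0, t.1] ![α, 1, t.2 + α * t.1])}
  obtain ⟨L, _, _, φ, hφ⟩ := exists_algHom_of_infinite hT
  obtain ⟨K, _, _, ι, c, m, D, hc, hm, hD⟩ := exists_derivation_adjoin_pair _ _ hφ
  have hchar := charZero_of_injective_algebraMap (algebraMap ℂ K).injective
  have hcond : ∀ α : ℂ, SquareCond (linePoly F ![1, 0, c]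
      ![algebraMap ℂ K α, 1, m + algebraMap ℂ K α * c]) := by
    intro α
    refine SquareCond.of_map (φ := (ι : K →+* L)) ι.injective ?_
    have h : SquareCond (linePoly F ![(1 : T → ℂ), 0, fun t => t.1.1]
        ![algebraMap ℂ (T → ℂ) α, 1,
          (fun t => t.1.2) + algebraMap ℂ (T → ℂ) α * fun t => t.1.1]) := by
      refine squareCond_pi fun t => ?_
      have := t.2 α
      have e := map_linePoly (Pi.evalAlgHom ℂ (fun _ : T => ℂ) t) F
        ![(1 : T → ℂ), 0, fun t => t.1.1]
        ![algebraMap ℂ (T → ℂ) α, 1, (fun t => t.1.2) + algebraMap ℂ (T → ℂ) α * fun t => t.1.1]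
      convert this using 1
      refine e.trans ?_
      congr 1 <;> ext i <;> fin_cases i <;> simp
    have h' := h.map (φ : (T → ℂ) →+* L)
    rw [map_linePoly] at h' ⊢
    convert h' using 2 <;> ext i <;> fin_cases i <;> simp [hc, hm]
  have hne := linePoly_ne_zero D hF hsq c m hD
  obtain ⟨x, hx0, hx⟩ : ∃ x : ℂ, x ≠ 0 ∧
      (linePoly F ![1, 0, c] ![0, 1, m]).eval (algebraMap ℂ K x) ≠ 0 := by
    by_contra! h
    apply hne
    refine Polynomial.eq_zero_of_infinite_isRoot _ (Set.Infinite.mono ?_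
      ((Set.infinite_of_finite_compl (s := {x : ℂ | x ≠ 0}) (by simp)).image
        (algebraMap ℂ K).injective.injOn))
    rintro _ ⟨x, hx, rfl⟩
    exact h x hx
  obtain ⟨a, p, s, hf⟩ := (hcond x⁻¹).exists_eq_sq (linePoly_natDegree_le_and_coeff hF _ _).1 (by
    rw [(linePoly_natDegree_le_and_coeff hF _ _).2]
    intro h
    apply hx
    have := isHomogeneous_aeval_mul_left hF (algebraMap ℂ K x)
      ![algebraMap ℂ K x⁻¹, 1, m + algebraMap ℂ K x⁻¹ * c]
    rw [h, mul_zero] at this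
    rw [eval_linePoly]
    refine (congrArg (fun w => aeval w F) (funext fun i => ?_)).trans this
    have hx1 : algebraMap ℂ K x ≠ 0 := by simpa using hx0
    fin_cases i
    · simp [hx1]
    · simp
    · simp
      field_simp
      ring)
  refine linePoly_ne_const_mul_sq D hF hsq hquad x⁻¹ c _ ?_ a p s hf
  by_contra! h
  rcases hD with hD | hD
  · exact hD h.1
  · apply hD
    simpa [h.1, -map_inv₀] using h.2

theorem lineRest_eq_linePoly (F : MvPolynomial (Fin 3) ℂ) (a b : Fin 3 → ℂ) :
    lineRest F a b = linePoly F a b := rfl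

theorem linePoly_rename {R A : Type*} [CommRing R] [CommRing A] [Algebra R A] (σ : Fin 3 → Fin 3)
    (F : MvPolynomial (Fin 3) R) (u v : Fin 3 → A) :
    linePoly (rename σ F) u v = linePoly F (u ∘ σ) (v ∘ σ) := by
  rw [linePoly, aeval_rename]
  rfl

theorem linePoly_add_mul_left {R A : Type*} [CommRing R] [CommRing A] [Algebra R A]
    (F : MvPolynomial (Fin 3) R) (u v : Fin 3 → A) (ρ : A) :
    linePoly F (u + ρ • v) v = (linePoly F u v).comp (Polynomial.X + Polynomial.C ρ) := by
  refine Eq.trans ?_ (aeval_linePoly F u v (Polynomial.X + Polynomial.C ρ)).symm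
  refine congrArg (fun w => aeval w F) (funext fun i => ?_)
  simp only [Pi.add_apply, Pi.smul_apply, smul_eq_mul, map_add, map_mul,
    Polynomial.algebraMap_eq]
  ring

theorem lineThrough_subset (u v : Fin 3 → ℂ) (p q r s : ℂ) :
    lineThrough (p • u + q • v) (r • u + s • v) ⊆ lineThrough u v := by
  rintro _ ⟨x, y, h, rfl⟩
  have e : x • (p • u + q • v) + y • (r • u + s • v) =
      (x * p + y * r) • u + (x * q + y * s) • v := by module
  exact ⟨x * p + y * r, x * q + y * s, e ▸ h, by simp only [e]⟩

theorem eval_smul_eq_pow_mul {F : MvPolynomial (Fin 3) ℂ} {n : ℕ} (hF : F.IsHomogeneous n)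
    (t : ℂ) (w : Fin 3 → ℂ) : eval (t • w) F = t ^ n * eval w F :=
  isHomogeneous_aeval_mul_left hF t w

theorem eval_eq_zero_of_mk_eq {F : MvPolynomial (Fin 3) ℂ} {n : ℕ} (hF : F.IsHomogeneous n)
    {w z : Fin 3 → ℂ} (hw : w ≠ 0) (hz : z ≠ 0)
    (h : Projectivization.mk ℂ w hw = Projectivization.mk ℂ z hz) (h0 : eval z F = 0) :
    eval w F = 0 := by
  obtain ⟨t, rfl⟩ := (Projectivization.mk_eq_mk_iff' ℂ _ _ hw hz).1 h
  rw [eval_smul_eq_pow_mul hF, h0, mul_zero]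

theorem exists_eval_pderiv_pderiv_ne_zero {F : MvPolynomial (Fin 3) ℂ} (hF : F.IsHomogeneous 4)
    (hdouble : ∀ p : P2, IsSingularAt F p → IsDoublePoint F p) (z : Fin 3 → ℂ) (hz : z ≠ 0) :
    ∃ i j, eval z (pderiv i (pderiv j F)) ≠ 0 := by
  by_contra! h2
  have h1 : ∀ i, eval z (pderiv i F) = 0 := by
    intro i
    have := aeval_euler (hF.pderiv (i := i)) z
    simp only [MvPolynomial.aeval_eq_eval, h2] at this
    simpa using this.symm
  have h0 : eval z F = 0 := by
    have := aeval_euler hF z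
    simp only [MvPolynomial.aeval_eq_eval, h1] at this
    simpa using this.symm
  have h3 : VanishesToOrder F (Projectivization.mk ℂ z hz) 3 := by
    intro l hl w hw hwz
    match l, hl with
    | [], _ => exact eval_eq_zero_of_mk_eq hF hw hz hwz h0
    | [i], _ => exact eval_eq_zero_of_mk_eq hF.pderiv hw hz hwz (h1 i)
    | [i, j], _ => exact eval_eq_zero_of_mk_eq hF.pderiv.pderiv hw hz hwz (h2 i j)
    | _ :: _ :: _ :: _, hl => simp at hl; omega
  exact (hdouble _ fun l hl => h3 l (by omega)).2 h3

theorem exists_eval_pderiv_pderiv_rename_ne_zero {F : MvPolynomial (Fin 3) ℂ}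
    (hquad : ∀ z : Fin 3 → ℂ, z ≠ 0 → ∃ i j, eval z (pderiv i (pderiv j F)) ≠ 0)
    (σ : Equiv.Perm (Fin 3)) (z : Fin 3 → ℂ) (hz : z ≠ 0) :
    ∃ i j, eval z (pderiv i (pderiv j (rename σ F))) ≠ 0 := by
  obtain ⟨i, j, h⟩ := hquad (z ∘ σ) fun h => hz <| by
    ext l
    simpa using congrFun h (σ.symm l)
  refine ⟨σ i, σ j, ?_⟩
  rwa [pderiv_rename σ.injective, pderiv_rename σ.injective, eval_rename]

theorem exists_perm_lineThrough {S : Set P2} (hS : IsLine S) :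
    ∃ (σ : Equiv.Perm (Fin 3)) (c m : ℂ),
      S = lineThrough (![1, 0, c] ∘ σ) (![0, 1, m] ∘ σ) := by
  obtain ⟨a, b, hab, rfl⟩ := hS
  rw [LinearIndependent.pair_iff] at hab
  obtain ⟨i, j, hij⟩ : ∃ i j, a i * b j - a j * b i ≠ 0 := by
    by_contra! h
    have ha : a = 0 := by
      ext i
      refine neg_eq_zero.1 (hab (b i) (-a i) ?_).2
      ext j
      simp
      linear_combination -h i j
    exact one_ne_zero (hab 1 0 (by simp [ha])).1
  have hne : i ≠ j := by
    rintro rfl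
    exact hij (sub_self _)
  obtain ⟨σ, hi, hj⟩ : ∃ σ : Equiv.Perm (Fin 3), σ i = 0 ∧ σ j = 1 := by
    revert hne
    clear hij
    decide +revert
  set Δ := a i * b j - a j * b i with hΔ
  set u : Fin 3 → ℂ := (b j / Δ) • a + (-a j / Δ) • b with hu
  set v : Fin 3 → ℂ := (-b i / Δ) • a + (a i / Δ) • b with hv
  have ha : a = a i • u + a j • v := by
    ext l
    simp [hu, hv]
    field_simp
    rw [hΔ]
    ring
  have hb : b = b i • u + b j • v := by
    ext l
    simp [hu, hv]
    field_simp
    rw [hΔ]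
    ring
  have hσi : σ.symm 0 = i := by rw [← hi, σ.symm_apply_apply]
  have hσj : σ.symm 1 = j := by rw [← hj, σ.symm_apply_apply]
  have hui : u i = 1 := by
    simp [hu]
    field_simp
    rw [hΔ]
    ring
  have huj : u j = 0 := by
    simp [hu]
    field_simp
    ring
  have hvi : v i = 0 := by
    simp [hv]
    field_simp
    ring
  have hvj : v j = 1 := by
    simp [hv]
    field_simp
    rw [hΔ]
    ring
  have hu' : u = ![1, 0, u (σ.symm 2)] ∘ σ := by
    ext l
    obtain ⟨k, rfl⟩ := σ.symm.surjective l
    fin_cases k <;> simp [hσi, hσj, hi, hj, hui, huj]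
  have hv' : v = ![0, 1, v (σ.symm 2)] ∘ σ := by
    ext l
    obtain ⟨k, rfl⟩ := σ.symm.surjective l
    fin_cases k <;> simp [hσi, hσj, hi, hj, hvi, hvj]
  refine ⟨σ, u (σ.symm 2), v (σ.symm 2), ?_⟩
  rw [← hu', ← hv']
  apply Set.Subset.antisymm
  · conv_lhs => rw [ha, hb]
    exact lineThrough_subset _ _ _ _ _ _
  · exact lineThrough_subset _ _ _ _ _ _

theorem exists_eq_sq_of_two_le_rootMultiplicity {f : Polynomial ℂ} (hdeg : f.natDegree = 4)
    (hroot : ∀ ρ, f.IsRoot ρ → 2 ≤ f.rootMultiplicity ρ) :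
    ∃ a p s : ℂ, f = Polynomial.C a *
      (Polynomial.X ^ 2 + Polynomial.C p * Polynomial.X + Polynomial.C s) ^ 2 := by
  have hsplit := IsAlgClosed.splits f
  have hcard : f.roots.card = 4 := by rw [← hsplit.natDegree_eq_card_roots, hdeg]
  have hcount : ∀ ρ ∈ f.roots, 2 ≤ f.roots.count ρ := by
    intro ρ hρ
    rw [Polynomial.count_roots]
    exact hroot ρ (Polynomial.isRoot_of_mem_roots hρ)
  obtain ⟨r, s, hrs⟩ : ∃ r s, f.roots = {r, r, s, s} := by
    generalize f.roots = M at hcard hcount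
    obtain ⟨r, hr⟩ := Multiset.card_pos_iff_exists_mem.1 (by omega : 0 < M.card)
    obtain ⟨N, rfl⟩ := Multiset.le_iff_exists_add.1
      (Multiset.le_count_iff_replicate_le.1 (hcount r hr))
    rw [Multiset.card_add, Multiset.card_replicate] at hcard
    obtain ⟨s, t, rfl⟩ := Multiset.card_eq_two.1 (by omega : N.card = 2)
    by_cases hst : s = t
    · exact ⟨r, s, by subst hst; rfl⟩
    · exfalso
      have h1 := hcount s (by simp)
      have h2 := hcount t (by simp)
      have hsr : s = r := by
        by_contra hsr
        rw [Multiset.count_add, Multiset.count_replicate, if_neg (Ne.symm hsr),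
          Multiset.insert_eq_cons, Multiset.count_cons_self, Multiset.count_singleton,
          if_neg hst] at h1
        omega
      have htr : t = r := by
        by_contra htr
        rw [Multiset.count_add, Multiset.count_replicate, if_neg (Ne.symm htr),
          Multiset.insert_eq_cons, Multiset.count_cons_of_ne (Ne.symm hst),
          Multiset.count_singleton_self] at h2
        omega
      exact hst (hsr.trans htr.symm)
  refine ⟨f.leadingCoeff, -(r + s), r * s, ?_⟩
  conv_lhs => rw [hsplit.eq_prod_roots, hrs]
  simp [-mul_eq_mul_left_iff]
  ring

theorem ThetaLine.squareCond {F : MvPolynomial (Fin 3) ℂ} (hF : F.IsHomogeneous 4)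
    {S : Set P2} (hS : ThetaLine F S) {a b : Fin 3 → ℂ} (hab : LinearIndependent ℂ ![a, b])
    (h : S = lineThrough a b) : SquareCond (linePoly F a b) := by
  by_cases h4 : (linePoly F a b).coeff 4 = 0
  · simp [SquareCond, h4]
  have hli := LinearIndependent.pair_iff.1 hab
  have hne : ∀ ρ : ℂ, a + ρ • b ≠ 0 := by
    intro ρ h0
    exact one_ne_zero (hli 1 ρ (by rwa [one_smul])).1
  have hroot : ∀ ρ, (linePoly F a b).IsRoot ρ ↔ eval (a + ρ • b) F = 0 := by
    intro ρ
    rw [Polynomial.IsRoot, eval_linePoly]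
    rfl
  rcases hS.2 with hsub | htan
  · exfalso
    apply h4
    have : linePoly F a b = 0 := Polynomial.funext fun ρ => by
      rw [Polynomial.eval_zero]
      refine (hroot ρ).2 (hsub (a := Projectivization.mk ℂ _ (hne ρ)) ?_ _ (hne ρ) rfl)
      rw [h]
      exact ⟨1, ρ, by rw [one_smul]; exact hne ρ, by simp only [one_smul]⟩
    rw [this, Polynomial.coeff_zero]
  · obtain ⟨c, p, s, hf⟩ := exists_eq_sq_of_two_le_rootMultiplicity
      (Polynomial.natDegree_eq_of_le_of_coeff_ne_zero (linePoly_natDegree_le_and_coeff hF a b).1 h4)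
      fun ρ hρ => by
        have := htan (a + ρ • b) b (by
          rw [LinearIndependent.pair_iff]
          intro x y hxy
          obtain ⟨hx, hy⟩ := hli x (x * ρ + y) (by rw [← hxy]; module)
          exact ⟨hx, by simpa [hx] using hy⟩) (by
          rw [h]
          apply Set.Subset.antisymm
          · simpa [sub_eq_add_neg] using lineThrough_subset (a + ρ • b) b 1 (-ρ) 0 1
          · simpa using lineThrough_subset a b 1 ρ 0 1) (hne ρ)
          fun w hw hwz => eval_eq_zero_of_mk_eq hF hw (hne ρ) hwz ((hroot ρ).1 hρ)
        rwa [multAt, lineRest_eq_linePoly, linePoly_add_mul_left,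
          ← Polynomial.rootMultiplicity_eq_rootMultiplicity] at this
    rw [hf]
    exact squareCond_const_mul_sq c p s

theorem ThetaLine.squareCond_rename {F : MvPolynomial (Fin 3) ℂ} (hF : F.IsHomogeneous 4)
    {S : Set P2} (hS : ThetaLine F S) (σ : Equiv.Perm (Fin 3)) (c m α : ℂ)
    (h : S = lineThrough (![1, 0, c] ∘ σ) (![0, 1, m] ∘ σ)) :
    SquareCond (linePoly (rename σ F) ![1, 0, c] ![α, 1, m + α * c]) := by
  rw [linePoly_rename]
  have hv : (![α, 1, m + α * c] ∘ σ : Fin 3 → ℂ) =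
      α • (![1, 0, c] ∘ σ) + (1 : ℂ) • (![0, 1, m] ∘ σ) := by
    ext l
    obtain ⟨k, rfl⟩ := σ.symm.surjective l
    fin_cases k <;> simp
    ring
  have hv' : (![0, 1, m] ∘ σ : Fin 3 → ℂ) =
      (-α) • (![1, 0, c] ∘ σ) + (1 : ℂ) • (![α, 1, m + α * c] ∘ σ) := by
    rw [hv]
    module
  refine hS.squareCond hF ?_ ?_
  · rw [LinearIndependent.pair_iff]
    intro x y hxy
    have h0 := congrFun hxy (σ.symm 0)
    have h1 := congrFun hxy (σ.symm 1)
    simp at h0 h1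
    simpa [h1] using h0
  · rw [h]
    apply Set.Subset.antisymm
    · conv_lhs => rw [hv']
      simpa using lineThrough_subset (![1, 0, c] ∘ σ) (![α, 1, m + α * c] ∘ σ) 1 0 (-α) 1
    · rw [hv]
      simpa using lineThrough_subset (![1, 0, c] ∘ σ) (![0, 1, m] ∘ σ) 1 0 α 1

/-- A reduced plane quartic all of whose singular points are double
points has only finitely many theta-lines. -/
theorem quartic_finitely_many_theta_lines
    (F : MvPolynomial (Fin 3) ℂ) (hF0 : F ≠ 0) (hF4 : F.IsHomogeneous 4)
    (hred : Squarefree F)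
    (hdouble : ∀ p : P2, IsSingularAt F p → IsDoublePoint F p) :
    {S : Set P2 | ThetaLine F S}.Finite := by
  have hquad := exists_eval_pderiv_pderiv_ne_zero hF4 hdouble
  have hfin : ∀ σ : Equiv.Perm (Fin 3), {t : ℂ × ℂ | ∀ α : ℂ, SquareCond
      (linePoly (rename σ F) ![1, 0, t.1] ![α, 1, t.2 + α * t.1])}.Finite := by
    intro σ
    have h1 : (rename σ F).IsHomogeneous 4 := hF4.rename_isHomogeneous
    have h2 : Squarefree (rename σ F) :=
      hred.map_mulEquiv (renameEquiv ℂ σ).toMulEquiv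
    have h3 := exists_eval_pderiv_pderiv_rename_ne_zero hquad σ
    exact finite_squareCond h1 h2 h3
  have hsub : {S : Set P2 | ThetaLine F S} ⊆ ⋃ σ : Equiv.Perm (Fin 3),
      (fun t : ℂ × ℂ => lineThrough (![1, 0, t.1] ∘ σ) (![0, 1, t.2] ∘ σ)) ''
        {t : ℂ × ℂ | ∀ α : ℂ, SquareCond
          (linePoly (rename σ F) ![1, 0, t.1] ![α, 1, t.2 + α * t.1])} := by
    intro S hS
    obtain ⟨σ, c, m, h⟩ := exists_perm_lineThrough hS.1
    exact Set.mem_iUnion.2 ⟨σ, (c, m), fun α => hS.squareCond_rename hF4 σ c m α h, h.symm⟩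
  exact (Set.finite_iUnion fun σ => (hfin σ).image _).subset hsub

end
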